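/- arXiv:2507.15980 — 2 statements merged into one kernel-verified Lean document; each statement's English description precedes it below -/
import Mathlib

section
/- For every σ > 2, every compact set K contained in ℝ \ 𝓑 (the complement of the Brjuno set), and every Borel probability measure μ with support contained in K, the energy integral I¹_σ(μ) = ∬_{K×K} k¹_σ(x,ξ) dμ(x) dμ(ξ) is equal to +∞ (equivalently, K has zero C_σ-capacity with respect to the kernel k¹_σ). -/
open MeasureTheory Filter ENNReal

/-- The `n`-th denominator of the continued fraction expansion of `α`. -/
noncomputable def cfDen (α : ℝ) (n : ℕ) : ℝ := (GenContFract.of α).dens n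

/-- The Brjuno set: irrational numbers whose continued fraction denominators satisfy
`∑_{n≥1} (ln Q_{n+1})/Q_n < +∞`. -/
def BrjunoSet : Set ℝ :=
  {α | Irrational α ∧
    Summable (fun n : ℕ => Real.log (cfDen α (n + 2)) / cfDen α (n + 1))}

/-- The kernel `k¹_σ(x,ξ) = (ln|x−ξ|)² · |ln ln(e + 1/|x−ξ|)|^σ`, with value `⊤` on the
diagonal. -/
noncomputable def brjunoKernel (σ : ℝ) (x ξ : ℝ) : ℝ≥0∞ :=
  if x = ξ then ⊤
  else ENNReal.ofReal ((Real.log |x - ξ|) ^ 2 *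
    |Real.log (Real.log (Real.exp 1 + 1 / |x - ξ|))| ^ σ)

section ContinuedFraction

open GenContFract

theorem Irrational.not_terminatedAt {x : ℝ} (hx : Irrational x) (n : ℕ) :
    ¬ (GenContFract.of x).TerminatedAt n := fun h => by
  obtain ⟨q, hq⟩ := (terminates_iff_rat x).1 ⟨n, h⟩
  exact hx ⟨q, hq.symm⟩

theorem exists_int_contsAux (x : ℝ) (n : ℕ) :
    (∃ p q : ℤ, (GenContFract.of x).contsAux n = ⟨(p : ℝ), (q : ℝ)⟩) ∧
      ∃ p q : ℤ, (GenContFract.of x).contsAux (n + 1) = ⟨(p : ℝ), (q : ℝ)⟩ := by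
  induction n with
  | zero => exact ⟨⟨1, 0, by simp [contsAux]⟩, ⟨⌊x⌋, 1, by simp [contsAux, of_h_eq_floor]⟩⟩
  | succ n ih =>
    refine ⟨ih.2, ?_⟩
    obtain ⟨⟨p, q, h⟩, p', q', h'⟩ := ih
    cases hs : (GenContFract.of x).s.get? n with
    | none =>
      refine ⟨p', q', ?_⟩
      rw [← h']
      exact contsAux_stable_step_of_terminated hs
    | some gp =>
      obtain ⟨ha, z, hz⟩ := of_partNum_eq_one_and_exists_int_partDen_eq hs
      refine ⟨z * p' + p, z * q' + q, ?_⟩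
      rw [contsAux_recurrence hs h h', ha, hz]
      push_cast
      simp

theorem exists_int_nums_dens (x : ℝ) (n : ℕ) :
    ∃ p q : ℤ, (GenContFract.of x).nums n = p ∧ (GenContFract.of x).dens n = q := by
  obtain ⟨-, p, q, h⟩ := exists_int_contsAux x n
  exact ⟨p, q, by rw [num_eq_conts_a, nth_cont_eq_succ_nth_contAux, h],
    by rw [den_eq_conts_b, nth_cont_eq_succ_nth_contAux, h]⟩

theorem fib_le_cfDen {x : ℝ} (hx : Irrational x) (n : ℕ) : (Nat.fib (n + 1) : ℝ) ≤ cfDen x n :=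
  succ_nth_fib_le_of_nth_den (Or.inr (hx.not_terminatedAt _))

theorem cfDen_pos {x : ℝ} (hx : Irrational x) (n : ℕ) : 0 < cfDen x n :=
  lt_of_lt_of_le (by exact_mod_cast Nat.fib_pos.2 n.succ_pos) (fib_le_cfDen hx n)

theorem den_convergent {x : ℝ} (hx : Irrational x) (n : ℕ) :
    ((x.convergent n).den : ℝ) = cfDen x n := by
  obtain ⟨p, q, hp, hq⟩ := exists_int_nums_dens x n
  obtain ⟨p', q', hp', hq'⟩ := exists_int_nums_dens x (n + 1)
  have hdet : (GenContFract.of x).nums n * (GenContFract.of x).dens (n + 1) -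
      (GenContFract.of x).dens n * (GenContFract.of x).nums (n + 1) = (-1) ^ (n + 1) :=
    SimpContFract.determinant (s := SimpContFract.of x) (hx.not_terminatedAt n)
  rw [hp, hq, hp', hq'] at hdet
  have hdet' : p * q' - q * p' = (-1) ^ (n + 1) := by exact_mod_cast hdet
  have hqpos : 0 < q := by
    have h := cfDen_pos hx n
    rw [cfDen, hq] at h
    exact_mod_cast h
  have hcop : IsCoprime p q := by
    refine ⟨(-1) ^ (n + 1) * q', -(-1) ^ (n + 1) * p', ?_⟩
    have : ((-1 : ℤ) ^ (n + 1)) * (-1) ^ (n + 1) = 1 := by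
      rw [← mul_pow]; simp
    calc _ = (-1 : ℤ) ^ (n + 1) * (p * q' - q * p') := by ring
      _ = 1 := by rw [hdet', this]
  have hconv : x.convergent n = (p : ℚ) / q := by
    have h := Real.convs_eq_convergent x n
    rw [conv_eq_num_div_den, hp, hq] at h
    exact_mod_cast h.symm
  have hden : ((x.convergent n).den : ℤ) = q := by
    rw [hconv]
    exact Rat.den_div_eq_of_coprime hqpos (Int.isCoprime_iff_nat_coprime.1 hcop)
  rw [cfDen, hq, ← hden]
  simp

theorem cfDen_succ_lt {x : ℝ} (hx : Irrational x) (n : ℕ) :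
    cfDen x (n + 1) < cfDen x (n + 2) := by
  obtain ⟨gp, hs⟩ := Option.ne_none_iff_exists'.1 (hx.not_terminatedAt (n + 1))
  have ha := (of_partNum_eq_one_and_exists_int_partDen_eq hs).1
  have hb : 1 ≤ gp.b := of_one_le_get?_partDen (partDen_eq_s_b hs)
  have hrec : cfDen x (n + 2) = gp.b * cfDen x (n + 1) + gp.a * cfDen x n :=
    dens_recurrence hs rfl rfl
  have := cfDen_pos hx n
  have := cfDen_pos hx (n + 1)
  rw [hrec, ha]
  nlinarith

theorem convergent_succ_injective {x : ℝ} (hx : Irrational x) :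
    Function.Injective fun n => x.convergent (n + 1) := by
  intro m n h
  refine (strictMono_nat_of_lt_succ (f := fun n => cfDen x (n + 1)) (cfDen_succ_lt hx)).injective ?_
  simp only [← den_convergent hx]
  exact congrArg (fun r : ℚ => (r.den : ℝ)) h

theorem abs_sub_convergent_le {x : ℝ} (hx : Irrational x) (n : ℕ) :
    |x - x.convergent n| ≤ 1 / (cfDen x n * cfDen x (n + 1)) := by
  rw [← Real.convs_eq_convergent]
  exact abs_sub_convs_le (hx.not_terminatedAt n)

theorem pow_le_fib (n : ℕ) : ((3 / 2 : ℝ)) ^ n ≤ Nat.fib (n + 2) := by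
  induction n using Nat.twoStepInduction with
  | zero => simp
  | one => norm_num [Nat.fib_add_two]
  | more n h₀ h₁ =>
    rw [Nat.fib_add_two]
    push_cast
    have : (0 : ℝ) < (3 / 2) ^ n := by positivity
    rw [pow_succ] at h₁
    rw [pow_add]
    linarith

theorem summable_one_div_sqrt_cfDen {x : ℝ} (hx : Irrational x) :
    Summable fun n => 1 / √(cfDen x (n + 1)) := by
  have h1 : 1 < √(3 / 2 : ℝ) := by
    rw [Real.lt_sqrt] <;> norm_num
  refine Summable.of_nonneg_of_le (fun n => by positivity) (fun n => ?_)
    (summable_geometric_of_lt_one (r := 1 / √(3 / 2 : ℝ)) (by positivity)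
      (by rw [div_lt_one] <;> linarith))
  rw [one_div_pow]
  refine one_div_le_one_div_of_le (by positivity) (Real.le_sqrt_of_sq_le ?_)
  rw [← pow_mul, mul_comm, pow_mul, Real.sq_sqrt (by norm_num)]
  exact (pow_le_fib n).trans (fib_le_cfDen hx (n + 1))

end ContinuedFraction

/-- The rationals in `[-M, M]` of denominator at most `4 ^ k`; empty for small `k`. -/
def boundedRats (M k : ℕ) : Set ℚ :=
  {r | 5 ≤ k ∧ r.den ≤ 4 ^ k ∧ |(r : ℝ)| ≤ M}

/-- The points exponentially close to `r` at scale `k`. -/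
def expBall (k : ℕ) (r : ℚ) : Set ℝ := Metric.closedBall (r : ℝ) (Real.exp (-2 ^ k))

/-- A majorant, up to a convergent series, of the Brjuno sum of `x`. -/
noncomputable def approxSum (M : ℕ) (x : ℝ) : ℝ≥0∞ :=
  ∑' k, ∑' r : boundedRats M k,
    (expBall k r).indicator (fun _ => ENNReal.ofReal (2 ^ k / (r : ℚ).den)) x

theorem measurableSet_expBall (k : ℕ) (r : ℚ) : MeasurableSet (expBall k r) :=
  Metric.isClosed_closedBall.measurableSet

theorem mem_expBall {k : ℕ} {r : ℚ} {x : ℝ} :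
    x ∈ expBall k r ↔ |x - r| ≤ Real.exp (-2 ^ k) := by
  rw [expBall, Metric.mem_closedBall, Real.dist_eq]

theorem abs_le_of_mem_expBall {M k : ℕ} {r : ℚ} {x : ℝ} (hx : |x| + 1 ≤ M)
    (h : x ∈ expBall k r) : |(r : ℝ)| ≤ M := by
  have h1 : Real.exp (-2 ^ k) ≤ 1 := Real.exp_le_one_iff.2 (by simp)
  have h2 := (abs_sub_abs_le_abs_sub (r : ℝ) x).trans_eq (abs_sub_comm _ _)
  linarith [mem_expBall.1 h]

theorem approxSum_ratCast {M : ℕ} {r : ℚ} (hr : |(r : ℝ)| + 1 ≤ M) : approxSum M r = ⊤ := by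
  by_contra h
  have h0 := ENNReal.tendsto_cofinite_zero_of_tsum_ne_top h
  rw [Nat.cofinite_eq_atTop] at h0
  obtain ⟨k, hk1, hk5, hkd⟩ := ((h0.eventually (gt_mem_nhds one_pos)).and
    ((eventually_ge_atTop 5).and (eventually_ge_atTop r.den))).exists
  have hd2 : r.den ≤ 2 ^ k := hkd.trans Nat.lt_two_pow_self.le
  have hmem : r ∈ boundedRats M k :=
    ⟨hk5, hd2.trans (Nat.pow_le_pow_left (by norm_num) k), by linarith⟩
  refine hk1.not_ge (le_trans ?_ (ENNReal.le_tsum (⟨r, hmem⟩ : boundedRats M k)))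
  rw [Set.indicator_of_mem (mem_expBall.2 (by simpa using (Real.exp_pos _).le)),
    ENNReal.one_le_ofReal, one_le_div (by exact_mod_cast r.den_pos)]
  exact_mod_cast hd2

theorem approxSum_eq_tsum_rat (M : ℕ) (x : ℝ) :
    approxSum M x = ∑' r : ℚ, ∑' k, (boundedRats M k).indicator (fun r =>
      (expBall k r).indicator (fun _ => ENNReal.ofReal (2 ^ k / (r : ℚ).den)) x) r := by
  rw [ENNReal.tsum_comm, approxSum]
  exact tsum_congr fun k => tsum_subtype (boundedRats M k) fun r =>
    (expBall k r).indicator (fun _ => ENNReal.ofReal (2 ^ k / (r : ℚ).den)) x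

theorem summable_log_cfDen_div_cfDen {M : ℕ} {x : ℝ} (hx : Irrational x) (hM : |x| + 1 ≤ M)
    (h : approxSum M x ≠ ⊤) :
    Summable fun n : ℕ => Real.log (cfDen x (n + 2)) / cfDen x (n + 1) := by
  rw [approxSum_eq_tsum_rat] at h
  set G : ℚ → ℝ≥0∞ := fun r => ∑' k, (boundedRats M k).indicator (fun r =>
      (expBall k r).indicator (fun _ => ENNReal.ofReal (2 ^ k / (r : ℚ).den)) x) r
  have hG : ∑' n, G (x.convergent (n + 1)) ≠ ⊤ :=
    ne_top_of_le_ne_top h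
      (ENNReal.tsum_comp_le_tsum_of_injective (convergent_succ_injective hx) G)
  have one_le (n : ℕ) : 1 ≤ cfDen x n :=
    le_trans (by exact_mod_cast Nat.fib_pos.2 n.succ_pos) (fib_le_cfDen hx n)
  refine Summable.of_nonneg_of_le
    (fun n => div_nonneg (Real.log_nonneg (one_le _)) (cfDen_pos hx _).le) (fun n => ?_)
    (((summable_one_div_sqrt_cfDen hx).mul_left 34).add
      ((ENNReal.summable_toReal hG).mul_left 2))
  have hQ := one_le (n + 1)
  have hQ' := one_le (n + 2)
  set Q := cfDen x (n + 1) with hQdef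
  set Q' := cfDen x (n + 2)
  have hs : 1 ≤ √Q := Real.one_le_sqrt.2 hQ
  have hsq : √Q * √Q = Q := Real.mul_self_sqrt (by linarith)
  have hGn : 0 ≤ (G (x.convergent (n + 1))).toReal := ENNReal.toReal_nonneg
  have small {c : ℝ} (hc : c ≤ 34 * √Q) :
      c / Q ≤ 34 * (1 / √Q) + 2 * (G (x.convergent (n + 1))).toReal := by
    have : c / Q ≤ 34 * (1 / √Q) := by
      rw [← Real.sqrt_div_self', ← mul_div_assoc]
      gcongr
    linarith
  rcases lt_or_ge (Real.log Q') 32 with hL | hL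
  · exact small (by linarith)
  obtain ⟨k, hk, hk'⟩ := exists_nat_pow_near (x := Real.log Q') (by linarith) one_lt_two
  have hk5 : 5 ≤ k := by
    have : (2 : ℝ) ^ 5 < 2 ^ (k + 1) := by linarith
    have := (pow_lt_pow_iff_right₀ (one_lt_two (α := ℝ))).1 this
    omega
  rcases lt_or_ge ((4 : ℝ) ^ k) Q with hkQ | hkQ
  · have : (2 : ℝ) ^ k ≤ √Q := Real.le_sqrt_of_sq_le (by
      rw [← pow_mul, mul_comm, pow_mul]; norm_num; exact hkQ.le)
    rw [pow_succ] at hk'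
    exact small (by linarith)
  have hden := den_convergent hx (n + 1)
  have hball : x ∈ expBall k (x.convergent (n + 1)) := by
    refine mem_expBall.2 ((abs_sub_convergent_le hx (n + 1)).trans ?_)
    rw [Real.exp_neg, ← one_div]
    refine one_div_le_one_div_of_le (Real.exp_pos _) ?_
    calc Real.exp (2 ^ k) ≤ Real.exp (Real.log Q') := Real.exp_le_exp.2 hk
      _ = Q' := Real.exp_log (by linarith)
      _ ≤ Q * Q' := le_mul_of_one_le_left (by linarith) hQ
  have hmem : x.convergent (n + 1) ∈ boundedRats M k :=
    ⟨hk5, by rw [hQdef, ← hden] at hkQ; exact_mod_cast hkQ, abs_le_of_mem_expBall hM hball⟩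
  have hle : ENNReal.ofReal (2 ^ k / Q) ≤ G (x.convergent (n + 1)) := by
    refine le_trans (le_of_eq ?_) (ENNReal.le_tsum k)
    rw [Set.indicator_of_mem hmem, Set.indicator_of_mem hball, hden]
  have hle' := (ENNReal.ofReal_le_iff_le_toReal (ENNReal.ne_top_of_tsum_ne_top hG n)).1 hle
  have : Real.log Q' / Q ≤ 2 * (2 ^ k / Q) := by
    rw [← mul_div_assoc]
    gcongr
    rw [pow_succ] at hk'
    linarith
  have : 0 ≤ 34 * (1 / √Q) := by positivity
  linarith

theorem approxSum_eq_top {M : ℕ} {x : ℝ} (hM : |x| + 1 ≤ M) (hx : x ∉ BrjunoSet) :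
    approxSum M x = ⊤ := by
  by_cases hirr : Irrational x
  · by_contra h
    exact hx ⟨hirr, summable_log_cfDen_div_cfDen hirr hM h⟩
  · obtain ⟨r, rfl⟩ := not_not.1 hirr
    exact approxSum_ratCast hM

theorem tsum_boundedRats_le (M k : ℕ) (σ : ℝ) :
    ∑' r : boundedRats M k, ENNReal.ofReal (1 / ((r : ℚ).den ^ 2 * (k : ℝ) ^ σ)) ≤
      ENNReal.ofReal (3 * (2 * M + 1) * (k : ℝ) ^ (1 - σ)) := by
  rcases Nat.eq_zero_or_pos k with rfl | hk
  · have : IsEmpty (boundedRats M 0) := ⟨fun r => absurd r.2.1 (by norm_num)⟩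
    simp
  have hk0 : (0 : ℝ) < k := by exact_mod_cast hk
  have hkσ : 0 < (k : ℝ) ^ σ := Real.rpow_pos_of_pos hk0 σ
  let T : Finset (Σ _ : ℕ, ℤ) :=
    (Finset.Icc 1 (4 ^ k)).sigma fun q => Finset.Icc (-(M * q : ℤ)) (M * q)
  let g : (Σ _ : ℕ, ℤ) → ℝ≥0∞ := fun t => ENNReal.ofReal (1 / ((t.1 : ℝ) ^ 2 * (k : ℝ) ^ σ))
  have hT (r : boundedRats M k) : (⟨(r : ℚ).den, (r : ℚ).num⟩ : Σ _ : ℕ, ℤ) ∈ T := by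
    obtain ⟨r, -, hden, habs⟩ := r
    have hd : (0 : ℝ) < r.den := by exact_mod_cast r.den_pos
    rw [Rat.cast_def, abs_div, abs_of_pos hd, div_le_iff₀ hd] at habs
    have habs' : |r.num| ≤ M * r.den := by exact_mod_cast habs
    simp only [T, Finset.mem_sigma, Finset.mem_Icc]
    exact ⟨⟨r.den_pos, hden⟩, abs_le.1 habs'⟩
  have hinj : Function.Injective fun r : boundedRats M k => (⟨_, hT r⟩ : T) := by
    intro r s h
    simp only [Subtype.mk.injEq, Sigma.mk.injEq, heq_eq_eq] at h
    exact Subtype.ext (Rat.ext h.2 h.1)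
  calc _ ≤ ∑' t : T, g t :=
        ENNReal.tsum_comp_le_tsum_of_injective hinj (fun t : T => g t)
    _ = ∑ t ∈ T, g t := Finset.tsum_subtype T g
    _ = ENNReal.ofReal (∑ t ∈ T, 1 / ((t.1 : ℝ) ^ 2 * (k : ℝ) ^ σ)) :=
        (ENNReal.ofReal_sum_of_nonneg fun t _ => by positivity).symm
    _ ≤ _ := ENNReal.ofReal_le_ofReal ?_
  have hcard (q : ℕ) : ((Finset.Icc (-(M * q : ℤ)) (M * q)).card : ℝ) = 2 * M * q + 1 := by
    rw [Int.card_Icc]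
    have : ((M * q + 1 - -(M * q) : ℤ).toNat : ℤ) = 2 * M * q + 1 := by
      have : (0 : ℤ) ≤ M * q := by positivity
      rw [Int.toNat_of_nonneg (by linarith)]
      ring
    exact_mod_cast this
  have hharm : (∑ q ∈ Finset.Icc (1 : ℕ) (4 ^ k), ((q : ℝ))⁻¹) ≤ 3 * k := by
    have h := harmonic_le_one_add_log (4 ^ k)
    rw [harmonic_eq_sum_Icc] at h
    push_cast at h
    have hlog : Real.log 4 ≤ 2 := by
      rw [show (4 : ℝ) = 2 ^ 2 by norm_num, Real.log_pow]
      have := Real.log_two_lt_d9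
      push_cast
      linarith
    rw [Real.log_pow] at h
    have : (1 : ℝ) ≤ k := by exact_mod_cast hk
    nlinarith
  rw [Finset.sum_sigma]
  calc _ ≤ ∑ q ∈ Finset.Icc (1 : ℕ) (4 ^ k), (2 * M + 1) * ((k : ℝ) ^ σ)⁻¹ * ((q : ℝ))⁻¹ := by
        refine Finset.sum_le_sum fun q hq => ?_
        have hq1 : (1 : ℝ) ≤ q := by exact_mod_cast (Finset.mem_Icc.1 hq).1
        simp only [Finset.sum_const, nsmul_eq_mul]
        rw [hcard, mul_one_div, div_le_iff₀ (by positivity)]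
        field_simp
        linarith
    _ = (2 * M + 1) * ((k : ℝ) ^ σ)⁻¹ * ∑ q ∈ Finset.Icc (1 : ℕ) (4 ^ k), ((q : ℝ))⁻¹ := by
        rw [Finset.mul_sum]
    _ ≤ (2 * M + 1) * ((k : ℝ) ^ σ)⁻¹ * (3 * k) := by gcongr
    _ = _ := by
        rw [Real.rpow_sub hk0, Real.rpow_one]
        ring

theorem tsum_tsum_boundedRats_ne_top (M : ℕ) {σ : ℝ} (hσ : 2 < σ) :
    ∑' k : ℕ, ∑' r : boundedRats M k, ENNReal.ofReal (1 / ((r : ℚ).den ^ 2 * (k : ℝ) ^ σ)) ≠ ⊤ :=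
  ne_top_of_le_ne_top
    ((Real.summable_nat_rpow.2 (by linarith)).mul_left _).tsum_ofReal_ne_top
    (ENNReal.tsum_le_tsum fun k => tsum_boundedRats_le M k σ)

theorem two_mul_exp_neg_two_pow_lt {k : ℕ} (hk : 5 ≤ k) :
    2 * Real.exp (-2 ^ k) < 1 / (4 ^ k * 4 ^ k) := by
  have hpow : (5 * k + 7 : ℕ) ≤ 2 ^ k := by
    induction k, hk using Nat.le_induction with
    | base => norm_num
    | succ k hk ih => rw [pow_succ]; omega
  have hlog := Real.log_two_lt_d9
  have h2 : (2 : ℝ) * (4 ^ k * 4 ^ k) = Real.exp ((4 * k + 1) * Real.log 2) := by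
    rw [mul_comm _ (Real.log 2), Real.exp_mul, Real.exp_log two_pos, ← mul_pow,
      show (4 * k + 1 : ℝ) = ((4 * k + 1 : ℕ) : ℝ) by push_cast; ring, Real.rpow_natCast, pow_succ,
      pow_mul]
    norm_num
    ring
  rw [lt_div_iff₀ (by positivity), mul_right_comm, h2, ← Real.exp_add, Real.exp_lt_one_iff]
  have hpow' : (5 * k + 7 : ℝ) ≤ 2 ^ k := by exact_mod_cast hpow
  nlinarith [Real.log_nonneg (one_le_two (α := ℝ))]

theorem eq_of_mem_expBall {M k : ℕ} {r s : ℚ} {x : ℝ} (hr : r ∈ boundedRats M k)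
    (hs : s ∈ boundedRats M k) (hxr : x ∈ expBall k r) (hxs : x ∈ expBall k s) : r = s := by
  by_contra hne
  have hdist : |(r : ℝ) - s| ≤ 2 * Real.exp (-2 ^ k) := by
    rw [mem_expBall] at hxr hxs
    rw [abs_le] at *
    constructor <;> linarith
  have hr0 : (0 : ℝ) < r.den := by exact_mod_cast r.den_pos
  have hs0 : (0 : ℝ) < s.den := by exact_mod_cast s.den_pos
  have hgap : 1 / ((r.den : ℝ) * s.den) ≤ |(r : ℝ) - s| := by
    have hnum : (r.num * s.den - s.num * r.den : ℤ) ≠ 0 := by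
      rw [sub_ne_zero]
      exact fun h => hne (Rat.eq_iff_mul_eq_mul.2 h)
    have h1 : (1 : ℝ) ≤ |(r.num : ℝ) * s.den - s.num * r.den| := by
      exact_mod_cast Int.one_le_abs hnum
    rw [Rat.cast_def r, Rat.cast_def s, div_sub_div _ _ hr0.ne' hs0.ne', abs_div,
      abs_of_pos (mul_pos hr0 hs0), mul_comm (r.den : ℝ) s.num]
    gcongr
  have hr4 : (r.den : ℝ) ≤ 4 ^ k := by exact_mod_cast hr.2.1
  have hs4 : (s.den : ℝ) ≤ 4 ^ k := by exact_mod_cast hs.2.1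
  have : 1 / ((4 : ℝ) ^ k * 4 ^ k) ≤ 1 / ((r.den : ℝ) * s.den) := by gcongr
  linarith [two_mul_exp_neg_two_pow_lt hr.1]

theorem scale_le_kernel {σ : ℝ} (hσ : 0 ≤ σ) {k : ℕ} (hk : 5 ≤ k) {x ξ : ℝ}
    (h : |x - ξ| ≤ 2 * Real.exp (-2 ^ k)) :
    ENNReal.ofReal (4 ^ k * (k : ℝ) ^ σ) ≤
      ENNReal.ofReal (4 * 2 ^ σ) * brjunoKernel σ x ξ := by
  have hc : (0 : ℝ) < 4 * 2 ^ σ := by positivity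
  rw [brjunoKernel]
  split_ifs with hx
  · rw [ENNReal.mul_top (by simpa using hc)]
    exact le_top
  rw [← ENNReal.ofReal_mul hc.le]
  refine ENNReal.ofReal_le_ofReal ?_
  have hd : 0 < |x - ξ| := abs_pos.2 (sub_ne_zero.2 hx)
  set d := |x - ξ|
  have hk' : (5 : ℝ) ≤ k := by exact_mod_cast hk
  have h2k : (32 : ℝ) ≤ 2 ^ k := by
    calc (32 : ℝ) = 2 ^ 5 := by norm_num
      _ ≤ 2 ^ k := pow_le_pow_right₀ one_le_two hk
  have hlog2 := Real.log_two_lt_d9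
  have hlog2' := Real.log_two_gt_d9
  have hlogd : Real.log d ≤ Real.log 2 - 2 ^ k := by
    calc Real.log d ≤ Real.log (2 * Real.exp (-2 ^ k)) := Real.log_le_log hd h
      _ = _ := by rw [Real.log_mul two_ne_zero (Real.exp_ne_zero _), Real.log_exp]; ring
  have hneg : (2 : ℝ) ^ k / 2 ≤ -Real.log d := by linarith
  have hsq : (4 : ℝ) ^ k ≤ 4 * Real.log d ^ 2 := by
    have : (4 : ℝ) ^ k = 2 ^ k * 2 ^ k := by rw [← mul_pow]; norm_num
    nlinarith
  have hll : (k : ℝ) / 2 ≤ Real.log (Real.log (Real.exp 1 + 1 / d)) := by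
    have h1 : (2 : ℝ) ^ k / 2 ≤ Real.log (Real.exp 1 + 1 / d) := by
      refine hneg.trans ?_
      rw [← Real.log_inv, ← one_div]
      exact Real.log_le_log (by positivity) (by linarith [Real.exp_pos 1])
    refine le_trans ?_ (Real.log_le_log (by positivity) h1)
    rw [Real.log_div (by positivity) two_ne_zero, Real.log_pow]
    nlinarith
  have hrpow : (k : ℝ) ^ σ ≤ 2 ^ σ * |Real.log (Real.log (Real.exp 1 + 1 / d))| ^ σ := by
    rw [← Real.mul_rpow zero_le_two (abs_nonneg _)]
    refine Real.rpow_le_rpow (by positivity) ?_ hσ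
    linarith [le_abs_self (Real.log (Real.log (Real.exp 1 + 1 / d)))]
  calc _ ≤ 4 * Real.log d ^ 2 * (2 ^ σ * |Real.log (Real.log (Real.exp 1 + 1 / d))| ^ σ) := by
        gcongr
    _ = _ := by ring

theorem tsum_boundedRats_indicator_le (M : ℕ) (σ : ℝ) (k : ℕ) (x ξ : ℝ) :
    ∑' r : boundedRats M k, (expBall k r).indicator (fun _ => (expBall k r).indicator
      (fun _ => ENNReal.ofReal (4 ^ k * (k : ℝ) ^ σ)) ξ) x ≤
      if 5 ≤ k ∧ |x - ξ| ≤ 2 * Real.exp (-2 ^ k) then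
        ENNReal.ofReal (4 ^ k * (k : ℝ) ^ σ) else 0 := by
  by_cases hex : ∃ r : boundedRats M k, x ∈ expBall k r ∧ ξ ∈ expBall k r
  · obtain ⟨r, hxr, hξr⟩ := hex
    rw [tsum_eq_single r, Set.indicator_of_mem hxr, Set.indicator_of_mem hξr, if_pos]
    · refine ⟨r.2.1, ?_⟩
      rw [mem_expBall, abs_le] at hxr hξr
      rw [abs_le]
      constructor <;> linarith
    · intro s hs
      refine Set.indicator_of_notMem (fun hxs => hs ?_) _
      exact Subtype.ext (eq_of_mem_expBall s.2 r.2 hxs hxr)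
  · rw [ENNReal.tsum_eq_zero.2]
    · exact zero_le
    · intro r
      simp only [Set.indicator_apply_eq_zero, ENNReal.ofReal_eq_zero]
      exact fun h1 h2 => (hex ⟨r, h1, h2⟩).elim

theorem sum_scale_le {σ : ℝ} (hσ : 0 ≤ σ) (n : ℕ) :
    ∑ k ∈ Finset.range (n + 1), (4 : ℝ) ^ k * (k : ℝ) ^ σ ≤ 2 * (4 ^ n * (n : ℝ) ^ σ) := by
  induction n with
  | zero =>
    have : (0 : ℝ) ≤ 0 ^ σ := Real.rpow_nonneg le_rfl σ
    simpa using by linarith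
  | succ n ih =>
    rw [Finset.sum_range_succ]
    have : (n : ℝ) ^ σ ≤ ((n + 1 : ℕ) : ℝ) ^ σ :=
      Real.rpow_le_rpow (by positivity) (by push_cast; linarith) hσ
    have h4 : (4 : ℝ) ^ n * (n : ℝ) ^ σ ≤ 4 ^ n * ((n + 1 : ℕ) : ℝ) ^ σ := by gcongr
    have : (0 : ℝ) ≤ 4 ^ n * (n : ℝ) ^ σ := by positivity
    rw [pow_succ]
    linarith

theorem tsum_tsum_le_kernel (M : ℕ) {σ : ℝ} (hσ : 0 ≤ σ) (x ξ : ℝ) :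
    ∑' k : ℕ, ∑' r : boundedRats M k, (expBall k r).indicator (fun _ => (expBall k r).indicator
      (fun _ => ENNReal.ofReal (4 ^ k * (k : ℝ) ^ σ)) ξ) x ≤
      2 * ENNReal.ofReal (4 * 2 ^ σ) * brjunoKernel σ x ξ := by
  refine (ENNReal.tsum_le_tsum fun k => tsum_boundedRats_indicator_le M σ k x ξ).trans ?_
  refine ENNReal.tsum_le_of_sum_range_le fun n => ?_
  induction n with
  | zero => simp
  | succ n ih =>
    by_cases hn : 5 ≤ n ∧ |x - ξ| ≤ 2 * Real.exp (-2 ^ n)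
    · calc _ ≤ ∑ k ∈ Finset.range (n + 1), ENNReal.ofReal (4 ^ k * (k : ℝ) ^ σ) :=
            Finset.sum_le_sum fun k _ => by split_ifs <;> simp
        _ = ENNReal.ofReal (∑ k ∈ Finset.range (n + 1), 4 ^ k * (k : ℝ) ^ σ) :=
            (ENNReal.ofReal_sum_of_nonneg fun k _ => by positivity).symm
        _ ≤ ENNReal.ofReal (2 * (4 ^ n * (n : ℝ) ^ σ)) :=
            ENNReal.ofReal_le_ofReal (sum_scale_le hσ n)
        _ = 2 * ENNReal.ofReal (4 ^ n * (n : ℝ) ^ σ) := by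
            rw [ENNReal.ofReal_mul zero_le_two, ENNReal.ofReal_ofNat]
        _ ≤ _ := by
            rw [mul_assoc]
            exact mul_le_mul_right (scale_le_kernel hσ hn.1 hn.2) 2
    · rwa [Finset.sum_range_succ, if_neg hn, add_zero]

theorem mul_measure_le (μ : Measure ℝ) [IsProbabilityMeasure μ] (s : Set ℝ) (σ : ℝ) {k q : ℕ}
    (hk : 0 < k) (hq : 0 < q) :
    ENNReal.ofReal (2 ^ k / q) * μ s ≤
      ENNReal.ofReal (4 ^ k * (k : ℝ) ^ σ) * (μ s * μ s) +
        ENNReal.ofReal (1 / ((q : ℝ) ^ 2 * (k : ℝ) ^ σ)) := by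
  have hq0 : (0 : ℝ) < q := by exact_mod_cast hq
  have hkσ : 0 < (k : ℝ) ^ σ := Real.rpow_pos_of_pos (by exact_mod_cast hk) σ
  rw [← ENNReal.ofReal_toReal (measure_ne_top μ s)]
  have hm : 0 ≤ (μ s).toReal := ENNReal.toReal_nonneg
  generalize (μ s).toReal = m at *
  generalize (k : ℝ) ^ σ = c at *
  rw [← ENNReal.ofReal_mul hm, ← ENNReal.ofReal_mul (by positivity),
    ← ENNReal.ofReal_mul (by positivity), ← ENNReal.ofReal_add (by positivity) (by positivity)]
  refine ENNReal.ofReal_le_ofReal ?_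
  have h4 : (4 : ℝ) ^ k = 2 ^ k * 2 ^ k := by rw [← mul_pow]; norm_num
  have hid : (4 : ℝ) ^ k * c * (m * m) + 1 / ((q : ℝ) ^ 2 * c) - 2 ^ k / q * m =
      c * ((2 ^ k * m - 1 / (q * c)) ^ 2 + 2 ^ k * m * (1 / (q * c))) := by
    rw [h4]
    field_simp
    ring
  have : 0 ≤ c * ((2 ^ k * m - 1 / (q * c)) ^ 2 + 2 ^ k * m * (1 / (q * c))) := by positivity
  linarith

theorem lintegral_approxSum_le (M : ℕ) {σ : ℝ} (hσ : 0 ≤ σ) (μ : Measure ℝ)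
    [IsProbabilityMeasure μ] :
    ∫⁻ x, approxSum M x ∂μ ≤
      2 * ENNReal.ofReal (4 * 2 ^ σ) * ∫⁻ x, ∫⁻ ξ, brjunoKernel σ x ξ ∂μ ∂μ +
        ∑' k : ℕ, ∑' r : boundedRats M k,
          ENNReal.ofReal (1 / ((r : ℚ).den ^ 2 * (k : ℝ) ^ σ)) := by
  have hmeas (k : ℕ) (r : ℚ) (c : ℝ≥0∞) : Measurable ((expBall k r).indicator fun _ => c) :=
    measurable_const.indicator (measurableSet_expBall k r)
  have henergy : ∑' k : ℕ, ∑' r : boundedRats M k, ENNReal.ofReal (4 ^ k * (k : ℝ) ^ σ) *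
      (μ (expBall k r) * μ (expBall k r)) ≤
      2 * ENNReal.ofReal (4 * 2 ^ σ) * ∫⁻ x, ∫⁻ ξ, brjunoKernel σ x ξ ∂μ ∂μ := by
    have hc : 2 * ENNReal.ofReal (4 * 2 ^ σ) ≠ ⊤ :=
      ENNReal.mul_ne_top (by simp) ENNReal.ofReal_ne_top
    calc _ = ∑' k : ℕ, ∑' r : boundedRats M k, ∫⁻ x, (expBall k r).indicator (fun _ =>
            ∫⁻ ξ, (expBall k r).indicator (fun _ => ENNReal.ofReal (4 ^ k * (k : ℝ) ^ σ)) ξ ∂μ) x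
              ∂μ := by
          simp only [lintegral_indicator_const (measurableSet_expBall _ _), mul_assoc]
      _ = ∫⁻ x, ∑' k : ℕ, ∑' r : boundedRats M k, (expBall k r).indicator (fun _ =>
            ∫⁻ ξ, (expBall k r).indicator (fun _ => ENNReal.ofReal (4 ^ k * (k : ℝ) ^ σ)) ξ ∂μ) x
              ∂μ := by
          rw [lintegral_tsum fun k => (Measurable.tsum fun r => hmeas _ _ _).aemeasurable]
          exact tsum_congr fun k => (lintegral_tsum fun r => (hmeas _ _ _).aemeasurable).symm
      _ = ∫⁻ x, ∫⁻ ξ, ∑' k : ℕ, ∑' r : boundedRats M k, (expBall k r).indicator (fun _ =>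
            (expBall k r).indicator (fun _ => ENNReal.ofReal (4 ^ k * (k : ℝ) ^ σ)) ξ) x
              ∂μ ∂μ := by
          refine lintegral_congr fun x => ?_
          have hmeas' (k : ℕ) (r : ℚ) : Measurable fun ξ => (expBall k r).indicator (fun _ =>
              (expBall k r).indicator (fun _ => ENNReal.ofReal (4 ^ k * (k : ℝ) ^ σ)) ξ) x := by
            by_cases hx : x ∈ expBall k r
            · simpa only [Set.indicator_of_mem hx] using hmeas k r _
            · simp only [Set.indicator_of_notMem hx, measurable_const]
          rw [lintegral_tsum fun k => (Measurable.tsum fun r => hmeas' _ _).aemeasurable]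
          refine tsum_congr fun k => ?_
          rw [lintegral_tsum fun r => (hmeas' _ _).aemeasurable]
          refine tsum_congr fun r => ?_
          by_cases hx : x ∈ expBall k r
          · simp only [Set.indicator_of_mem hx]
          · simp only [Set.indicator_of_notMem hx, lintegral_zero]
      _ ≤ ∫⁻ x, ∫⁻ ξ, 2 * ENNReal.ofReal (4 * 2 ^ σ) * brjunoKernel σ x ξ ∂μ ∂μ :=
          lintegral_mono fun x => lintegral_mono fun ξ => tsum_tsum_le_kernel M hσ x ξ
      _ = _ := by simp only [lintegral_const_mul' _ _ hc]
  calc ∫⁻ x, approxSum M x ∂μ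
      = ∑' k : ℕ, ∑' r : boundedRats M k,
          ENNReal.ofReal (2 ^ k / (r : ℚ).den) * μ (expBall k r) := by
        simp only [approxSum]
        rw [lintegral_tsum fun k => (Measurable.tsum fun r => hmeas _ _ _).aemeasurable]
        refine tsum_congr fun k => ?_
        rw [lintegral_tsum fun r => (hmeas _ _ _).aemeasurable]
        simp only [lintegral_indicator_const (measurableSet_expBall _ _)]
    _ ≤ ∑' k : ℕ, ∑' r : boundedRats M k, (ENNReal.ofReal (4 ^ k * (k : ℝ) ^ σ) *
          (μ (expBall k r) * μ (expBall k r)) +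
            ENNReal.ofReal (1 / ((r : ℚ).den ^ 2 * (k : ℝ) ^ σ))) :=
        ENNReal.tsum_le_tsum fun k => ENNReal.tsum_le_tsum fun r =>
          mul_measure_le μ _ σ (by have := r.2.1; omega) (r : ℚ).den_pos
    _ ≤ _ := by
        simp only [ENNReal.tsum_add]
        gcongr

/-- For every `σ > 2`, every compact `K ⊆ ℝ \ 𝓑` and every Borel probability measure `μ`
supported in `K`, the energy `I¹_σ(μ)` is infinite; i.e. `K` has zero `C_σ`-capacity with
respect to the kernel `k¹_σ`. -/
theorem brjuno_complement_zero_capacity (σ : ℝ) (hσ : 2 < σ)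
    (K : Set ℝ) (hK : IsCompact K) (hKsub : K ⊆ BrjunoSetᶜ)
    (μ : Measure ℝ) [IsProbabilityMeasure μ] (hμK : μ Kᶜ = 0) :
    ∫⁻ x, ∫⁻ ξ, brjunoKernel σ x ξ ∂μ ∂μ = ⊤ := by
  obtain ⟨C, hC⟩ := hK.isBounded.exists_norm_le
  obtain ⟨M, hM⟩ := exists_nat_ge (C + 1)
  have htop : ∫⁻ x, approxSum M x ∂μ = ⊤ := by
    have hae : ∀ᵐ x ∂μ, approxSum M x = ⊤ := by
      filter_upwards [show K ∈ ae μ from hμK] with x hx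
      exact approxSum_eq_top (by linarith [hC x hx, Real.norm_eq_abs x]) (hKsub hx)
    rw [lintegral_congr_ae hae]
    simp
  by_contra h
  have hle := lintegral_approxSum_le M (by linarith : 0 ≤ σ) μ
  rw [htop, top_le_iff] at hle
  refine ENNReal.add_ne_top.2 ⟨?_, tsum_tsum_boundedRats_ne_top M hσ⟩ hle
  exact ENNReal.mul_ne_top (ENNReal.mul_ne_top (by simp) ENNReal.ofReal_ne_top) h
end

section
/- Let α be an irrational number with continued fraction denominators Q_n, let ε > 0, and let 𝒩 = { n ∈ ℕ : (ln ln Q_{n+1})^{2+4ε} < (ln Q_n)^{2+3ε} }. Then ∑_{n ∈ 𝒩} (ln Q_{n+1})/Q_n < +∞. -/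
open MeasureTheory Filter

lemma three_halves_pow_le_two_mul_fib (n : ℕ) :
    (3 / 2 : ℝ) ^ n ≤ 2 * (Nat.fib (n + 1) : ℝ) ∧
      (3 / 2 : ℝ) ^ (n + 1) ≤ 2 * (Nat.fib (n + 2) : ℝ) := by
  induction n with
  | zero => norm_num
  | succ n ih =>
    refine ⟨ih.2, ?_⟩
    have hfib : (Nat.fib (n + 3) : ℝ) = Nat.fib (n + 1) + Nat.fib (n + 2) := by
      exact_mod_cast Nat.fib_add_two (n := n + 1)
    have hpos : (0 : ℝ) < (3 / 2) ^ n := by positivity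
    rw [show n + 1 + 2 = n + 3 by rfl, hfib, pow_succ]
    have h₁ := ih.1
    have h₂ := ih.2
    rw [pow_succ] at h₂ ⊢
    linarith

lemma fib_succ_le_cfDen {α : ℝ} (hα : Irrational α) (n : ℕ) :
    (Nat.fib (n + 1) : ℝ) ≤ cfDen α n := by
  refine GenContFract.succ_nth_fib_le_of_nth_den (Or.inr fun h => hα ?_)
  obtain ⟨q, hq⟩ := (GenContFract.terminates_iff_rat α).1 ⟨_, h⟩
  exact ⟨q, hq.symm⟩

lemma three_halves_pow_le_two_mul_cfDen {α : ℝ} (hα : Irrational α) (n : ℕ) :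
    (3 / 2 : ℝ) ^ n ≤ 2 * cfDen α n :=
  (three_halves_pow_le_two_mul_fib n).1.trans
    (mul_le_mul_of_nonneg_left (fib_succ_le_cfDen hα n) zero_le_two)

lemma tendsto_cfDen_atTop {α : ℝ} (hα : Irrational α) :
    Tendsto (cfDen α) atTop atTop := by
  have h : Tendsto (fun n : ℕ => (3 / 2 : ℝ) ^ n / 2) atTop atTop :=
    (tendsto_pow_atTop_atTop_of_one_lt (by norm_num)).atTop_div_const two_pos
  refine tendsto_atTop_mono (fun n => ?_) h
  linarith [three_halves_pow_le_two_mul_cfDen hα n]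

lemma eventually_rpow_le_half {θ : ℝ} (hθ : θ < 1) : ∀ᶠ x : ℝ in atTop, x ^ θ ≤ x / 2 := by
  have h := tendsto_rpow_neg_atTop (sub_pos.2 hθ)
  filter_upwards [h.eventually_le_const (show (0 : ℝ) < 1 / 2 by norm_num),
    eventually_gt_atTop 0] with x hx hx0
  rw [neg_sub, Real.rpow_sub_one hx0.ne', div_le_iff₀ hx0] at hx
  linarith

/-- For an irrational `α` and `ε > 0`, the sum of `(ln Q_{n+1})/Q_n` over the set
`𝒩 = {n : (ln ln Q_{n+1})^{2+4ε} < (ln Q_n)^{2+3ε}}` is finite. -/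
theorem brjuno_exceptional_set_summable (α : ℝ) (hα : Irrational α) (ε : ℝ) (hε : 0 < ε) :
    Summable (fun n : {n : ℕ //
        (Real.log (Real.log (cfDen α (n + 1)))) ^ (2 + 4 * ε) <
          (Real.log (cfDen α n)) ^ (2 + 3 * ε)} =>
      Real.log (cfDen α ((n : ℕ) + 1)) / cfDen α (n : ℕ)) := by
  have hθ : (2 + 3 * ε) / (2 + 4 * ε) < 1 := by
    rw [div_lt_one (by positivity)]
    linarith
  have hlog : Tendsto (fun n => Real.log (cfDen α n)) atTop atTop :=
    Real.tendsto_log_atTop.comp (tendsto_cfDen_atTop hα)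
  have hloglog : Tendsto (fun n => Real.log (Real.log (cfDen α (n + 1)))) atTop atTop :=
    Real.tendsto_log_atTop.comp (hlog.comp (tendsto_add_atTop_nat 1))
  have hgeom : Summable fun n : ℕ => √2 * (√(2 / 3)) ^ n := by
    refine (summable_geometric_of_lt_one (Real.sqrt_nonneg _) ?_).mul_left _
    rw [Real.sqrt_lt' one_pos]
    norm_num
  refine (summable_subtype_iff_indicator (s := {n : ℕ |
    (Real.log (Real.log (cfDen α (n + 1)))) ^ (2 + 4 * ε) <
      (Real.log (cfDen α n)) ^ (2 + 3 * ε)})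
    (f := fun n => Real.log (cfDen α (n + 1)) / cfDen α n)).2 ?_
  refine hgeom.of_norm_bounded_eventually_nat ?_
  filter_upwards [hlog.eventually (eventually_rpow_le_half hθ), hlog.eventually_gt_atTop 0,
    (hlog.comp (tendsto_add_atTop_nat 1)).eventually_gt_atTop 0,
    hloglog.eventually_gt_atTop 0, (tendsto_cfDen_atTop hα).eventually_gt_atTop 0]
    with n hhalf hlogn hlogn1 hloglogn hpos
  rw [Set.indicator_apply]
  split_ifs with hn
  · change 0 < Real.log (cfDen α (n + 1)) at hlogn1
    have hlt : Real.log (Real.log (cfDen α (n + 1))) <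
        Real.log (cfDen α n) ^ ((2 + 3 * ε) / (2 + 4 * ε)) := by
      have h : (2 + 4 * ε) ≠ 0 := by positivity
      rw [← Real.rpow_lt_rpow_iff hloglogn.le (by positivity) (by positivity : 0 < 2 + 4 * ε),
        ← Real.rpow_mul hlogn.le, div_mul_cancel₀ _ h]
      exact hn
    have hsqrt : Real.log (cfDen α (n + 1)) ≤ √(cfDen α n) := by
      rw [← Real.log_le_log_iff hlogn1 (Real.sqrt_pos.2 hpos), Real.log_sqrt hpos.le]
      exact hlt.le.trans hhalf
    rw [Real.norm_of_nonneg (by positivity)]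
    calc Real.log (cfDen α (n + 1)) / cfDen α n ≤ √(cfDen α n) / cfDen α n := by gcongr
      _ = √(cfDen α n)⁻¹ := by rw [Real.sqrt_div_self', Real.sqrt_inv, one_div]
      _ ≤ √(2 * (2 / 3) ^ n) := by
        refine Real.sqrt_le_sqrt ?_
        rw [inv_le_comm₀ hpos (by positivity), mul_inv, ← inv_pow, inv_div]
        linarith [three_halves_pow_le_two_mul_cfDen hα n]
      _ = √2 * √(2 / 3) ^ n := by
        have hpow : (2 / 3 : ℝ) ^ n = (√(2 / 3) ^ n) ^ 2 := by
          rw [← pow_mul, mul_comm, pow_mul, Real.sq_sqrt (by norm_num)]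
        rw [Real.sqrt_mul zero_le_two, hpow, Real.sqrt_sq (by positivity)]
  · rw [norm_zero]
    positivity
end
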